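/- arXiv:math/0608173 — 8 statements merged into one kernel-verified Lean document; each statement's English description precedes it below -/
import Mathlib

section
/- Let a₁, …, aₙ be nonzero real numbers and let δ = min_i |a_i|. Let T ⊆ ℝ be a union of m half-open intervals [t_j, t_j + w_j) with each width w_j ≤ δ. Then the number of subsets I ⊆ [n] such that ∑_{i ∈ I} a_i ∈ T is at most the sum of the m largest binomial coefficients among binom(n,0), …, binom(n,n), i.e. at most ∑_{i=0}^{m−1} binom(n, ⌊(n−m+1)/2⌋ + i). -/
open Finset

theorem Nat.choose_le_choose_right_of_le_half {n j k : ℕ} (hjk : j ≤ k) (hk : 2 * k ≤ n) :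
    n.choose j ≤ n.choose k := by
  induction k, hjk using Nat.le_induction with
  | base => rfl
  | succ k hjk ih =>
    exact (ih (by omega)).trans (Nat.choose_le_succ_of_lt_half_left (by omega))

theorem Nat.choose_le_choose_of_le_of_le_sub {n s k : ℕ} (hsk : s ≤ k) (hks : k ≤ n - s)
    (hs : s ≤ n) : n.choose s ≤ n.choose k := by
  rcases le_total (2 * k) n with h | h
  · exact Nat.choose_le_choose_right_of_le_half hsk h
  · rw [← Nat.choose_symm (show k ≤ n by omega)]
    exact Nat.choose_le_choose_right_of_le_half (by omega) (by omega)

theorem Nat.choose_le_choose_of_sub_le {n s k : ℕ} (hk : n - s ≤ k) (hkn : k ≤ n)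
    (hs : 2 * s ≤ n) : n.choose k ≤ n.choose s := by
  rw [← Nat.choose_symm hkn]
  exact Nat.choose_le_choose_right_of_le_half (by omega) hs

/-- A family of finite sets whose Lubell mass is at most `m` is no larger than the `m` middle layers
together. -/
theorem Finset.card_le_sum_choose_of_sum_inv_choose_le {α : Type*} [Fintype α] {m : ℕ}
    (𝒜 : Finset (Finset α))
    (h𝒜 : ∑ s ∈ 𝒜, ((Fintype.card α).choose #s : ℚ)⁻¹ ≤ m) :
    #𝒜 ≤ ∑ i ∈ range m, (Fintype.card α).choose ((Fintype.card α - m + 1) / 2 + i) := by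
  classical
  generalize hn : Fintype.card α = n at *
  have hcard : ∀ s ∈ 𝒜, #s ∈ range (n + 1) := fun s _ => by
    have := s.card_le_univ
    rw [mem_range]
    omega
  rcases Nat.lt_or_ge n m with hm | hm
  · have h0 : (n - m + 1) / 2 = 0 := by omega
    calc #𝒜 ≤ 2 ^ n := by rw [← hn, ← Fintype.card_finset]; exact card_le_univ _
      _ = ∑ i ∈ range (n + 1), n.choose i := (Nat.sum_range_choose n).symm
      _ ≤ ∑ i ∈ range m, n.choose i := sum_le_sum_of_subset (range_subset_range.2 hm)
      _ = _ := by simp [h0]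
  rcases Nat.eq_zero_or_pos m with rfl | hm0
  · have hz : ∀ s ∈ 𝒜, ((n.choose #s : ℚ)⁻¹) = 0 := by
      refine (sum_eq_zero_iff_of_nonneg fun s _ => by positivity).1 ?_
      exact le_antisymm (by simpa using h𝒜) (sum_nonneg fun s _ => by positivity)
    have : 𝒜 = ∅ := by
      refine eq_empty_of_forall_notMem fun s hs => ?_
      have hpos : 0 < n.choose #s :=
        Nat.choose_pos (Nat.lt_succ_iff.1 (mem_range.1 (hcard s hs)))
      have := hz s hs
      simp at this
      omega
    simp [this]
  set b := (n - m + 1) / 2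
  have hsub : Ico b (b + m) ⊆ range (n + 1) := fun k hk => by
    rw [mem_Ico] at hk; rw [mem_range]; omega
  have hpoint : ∀ k ∈ range (n + 1),
      (#{s ∈ 𝒜 | #s = k} : ℚ) - (if k ∈ Ico b (b + m) then (n.choose k : ℚ) else 0) ≤
        n.choose b * (#{s ∈ 𝒜 | #s = k} * (n.choose k : ℚ)⁻¹ -
          (if k ∈ Ico b (b + m) then 1 else 0)) := by
    intro k hk
    rw [mem_range, Nat.lt_succ_iff] at hk
    have hc : (0 : ℚ) < n.choose k := by exact_mod_cast Nat.choose_pos hk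
    have hx : (#{s ∈ 𝒜 | #s = k} : ℚ) ≤ n.choose k := by
      have : #{s ∈ 𝒜 | #s = k} ≤ n.choose k := by
        rw [← hn]
        exact Set.Sized.card_le fun s hs => (mem_filter.1 hs).2
      exact_mod_cast this
    obtain ⟨y, hy⟩ : ∃ y : ℚ, y = #{s ∈ 𝒜 | #s = k} * (n.choose k : ℚ)⁻¹ := ⟨_, rfl⟩
    have hxy : (#{s ∈ 𝒜 | #s = k} : ℚ) = y * n.choose k := by rw [hy]; field_simp
    have hy0 : 0 ≤ y := hy ▸ mul_nonneg (Nat.cast_nonneg _) (inv_nonneg.2 hc.le)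
    have hy1 : y ≤ 1 := by rw [hxy] at hx; exact le_of_mul_le_mul_right (by linarith) hc
    rw [← hy, hxy]
    split_ifs with hkS
    · rw [mem_Ico] at hkS
      have : (n.choose b : ℚ) ≤ n.choose k := by
        exact_mod_cast Nat.choose_le_choose_of_le_of_le_sub hkS.1 (by omega) (by omega)
      nlinarith
    · rw [mem_Ico] at hkS
      have : (n.choose k : ℚ) ≤ n.choose b := by
        rcases Nat.lt_or_ge k b with h | h
        · exact_mod_cast Nat.choose_le_choose_right_of_le_half h.le (by omega)
        · exact_mod_cast Nat.choose_le_choose_of_sub_le (by omega) hk (by omega)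
      nlinarith
  have hsum := sum_le_sum hpoint
  have hcount : ∑ k ∈ range (n + 1), (#{s ∈ 𝒜 | #s = k} : ℚ) = #𝒜 := by
    exact_mod_cast (card_eq_sum_card_fiberwise hcard).symm
  have hmass : ∑ k ∈ range (n + 1), (#{s ∈ 𝒜 | #s = k} : ℚ) * (n.choose k : ℚ)⁻¹ =
      ∑ s ∈ 𝒜, (n.choose #s : ℚ)⁻¹ := by
    rw [← sum_fiberwise_of_maps_to' hcard (fun k => (n.choose k : ℚ)⁻¹)]
    simp
  rw [sum_sub_distrib, ← mul_sum, sum_sub_distrib, hcount, hmass, sum_ite_mem, sum_ite_mem,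
    inter_eq_right.2 hsub, sum_Ico_eq_sum_range] at hsum
  simp only [sum_const, Nat.card_Ico, add_tsub_cancel_left, nsmul_eq_mul, mul_one] at hsum
  have : (#𝒜 : ℚ) ≤ ∑ i ∈ range m, (n.choose (b + i) : ℚ) := by
    nlinarith [Nat.cast_nonneg (α := ℚ) (n.choose b)]
  exact_mod_cast this

/-- A family of finite sets covered by `m` antichains is no larger than the `m` middle layers
together. -/
theorem Finset.card_le_sum_choose_of_subset_biUnion_antichains {α : Type*} [Fintype α]
    [DecidableEq α] {m : ℕ} (𝒜 : Finset (Finset α)) (ℬ : Fin m → Finset (Finset α))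
    (hℬ : ∀ j, IsAntichain (· ⊆ ·) (ℬ j : Set (Finset α))) (h𝒜 : 𝒜 ⊆ univ.biUnion ℬ) :
    #𝒜 ≤ ∑ i ∈ range m, (Fintype.card α).choose ((Fintype.card α - m + 1) / 2 + i) := by
  refine card_le_sum_choose_of_sum_inv_choose_le 𝒜 ?_
  calc ∑ s ∈ 𝒜, ((Fintype.card α).choose #s : ℚ)⁻¹
      ≤ ∑ s ∈ 𝒜, ∑ j, if s ∈ ℬ j then ((Fintype.card α).choose #s : ℚ)⁻¹ else 0 := by
        refine sum_le_sum fun s hs => ?_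
        obtain ⟨j, -, hj⟩ := mem_biUnion.1 (h𝒜 hs)
        refine (if_pos hj).symm.le.trans (single_le_sum
          (f := fun j => if s ∈ ℬ j then ((Fintype.card α).choose #s : ℚ)⁻¹ else 0)
          (fun j _ => ?_) (mem_univ j))
        positivity
    _ = ∑ j, ∑ s ∈ 𝒜 ∩ ℬ j, ((Fintype.card α).choose #s : ℚ)⁻¹ := by
        rw [sum_comm]
        simp only [sum_ite_mem]
    _ ≤ ∑ j, ∑ s ∈ ℬ j, ((Fintype.card α).choose #s : ℚ)⁻¹ :=
        sum_le_sum fun j _ => sum_le_sum_of_subset_of_nonneg inter_subset_right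
          fun s _ _ => by positivity
    _ ≤ ∑ _j : Fin m, 1 :=
        sum_le_sum fun j _ => lubell_yamamoto_meshalkin_inequality_sum_inv_choose (hℬ j)
    _ = m := by simp

/-- If all `x i` are at least `δ`, the sets whose sum lies in a half-open interval of width at most
`δ` form an antichain. -/
theorem isAntichain_sum_mem_Ico {ι : Type*} [DecidableEq ι] {x : ι → ℝ} {δ t w : ℝ}
    (hδ : 0 ≤ δ) (hx : ∀ i, δ ≤ x i) (hw : w ≤ δ) :
    IsAntichain (· ⊆ ·) {I : Finset ι | t ≤ ∑ i ∈ I, x i ∧ ∑ i ∈ I, x i < t + w} := by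
  intro I hI J hJ hne hIJ
  obtain ⟨k, hkJ, hkI⟩ := exists_of_ssubset (hIJ.ssubset_of_ne hne)
  have h : ∑ i ∈ insert k I, x i ≤ ∑ i ∈ J, x i :=
    sum_le_sum_of_subset_of_nonneg (insert_subset hkJ hIJ) fun i _ _ => hδ.trans (hx i)
  rw [sum_insert hkI] at h
  have := hx k
  have := hI.1
  have := hJ.2
  linarith

/-- Replacing `a` by `|a|` shifts all subset sums by a constant, after taking the symmetric
difference of the index set with the set of negative indices. -/
theorem sum_symmDiff_filter_neg_abs {ι : Type*} [Fintype ι] [DecidableEq ι] (a : ι → ℝ)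
    (I : Finset ι) :
    ∑ i ∈ symmDiff I ({i | a i < 0} : Finset ι), |a i| = ∑ i ∈ I, a i - ∑ i with a i < 0, a i := by
  rw [← filter_univ_mem (symmDiff _ _), ← filter_univ_mem I]
  simp only [sum_filter, ← sum_sub_distrib]
  refine sum_congr rfl fun i _ => ?_
  by_cases hI : i ∈ I <;> by_cases hi : a i < 0 <;>
    simp [mem_symmDiff, hI, hi, abs_of_neg, le_of_not_gt]

/-- (Littlewood–Offord, Erdős's form.) Let `a₁,…,aₙ` be nonzero reals and
`δ = min_i |a_i|`. Let `T` be a union of `m` half-open intervals `[t_j, t_j + w_j)` with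
each width `w_j ≤ δ`. Then the number of subsets `I ⊆ [n]` with `∑_{i ∈ I} a_i ∈ T` is at
most the sum of the `m` middle binomial coefficients,
`∑_{i=0}^{m−1} binom(n, ⌊(n−m+1)/2⌋ + i)`. -/
theorem stmt_9 (n m : ℕ) (hn : 0 < n) (a : Fin n → ℝ) (δ : ℝ)
    (ha : ∀ i, a i ≠ 0) (hδle : ∀ i, δ ≤ |a i|) (hδmin : ∃ i, δ = |a i|)
    (t w : Fin m → ℝ) (hw : ∀ j, w j ≤ δ) :
    (Finset.univ.filter (fun I : Finset (Fin n) =>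
        ∃ j, t j ≤ ∑ i ∈ I, a i ∧ ∑ i ∈ I, a i < t j + w j)).card ≤
      ∑ i ∈ Finset.range m, Nat.choose n ((n - m + 1) / 2 + i) := by
  classical
  have hδ : 0 ≤ δ := by
    obtain ⟨i, rfl⟩ := hδmin
    exact abs_nonneg _
  let N : Finset (Fin n) := {i | a i < 0}
  let c : ℝ := ∑ i ∈ N, a i
  have hinj : Function.Injective fun I : Finset (Fin n) => symmDiff I N :=
    symmDiff_left_injective N
  rw [← card_image_of_injective _ hinj]
  have key := card_le_sum_choose_of_subset_biUnion_antichains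
    (univ.filter (fun I : Finset (Fin n) =>
      ∃ j, t j ≤ ∑ i ∈ I, a i ∧ ∑ i ∈ I, a i < t j + w j) |>.image fun I => symmDiff I N)
    (fun j => univ.filter fun I : Finset (Fin n) =>
      t j - c ≤ ∑ i ∈ I, |a i| ∧ ∑ i ∈ I, |a i| < t j - c + w j)
    (fun j => by
      rw [coe_filter_univ]
      exact isAntichain_sum_mem_Ico hδ hδle (hw j)) ?_
  · simpa only [Fintype.card_fin] using key
  · intro J hJ
    obtain ⟨I, hI, rfl⟩ := mem_image.1 hJ
    obtain ⟨j, h1, h2⟩ := (mem_filter.1 hI).2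
    refine mem_biUnion.2 ⟨j, mem_univ j, mem_filter.2 ⟨mem_univ _, ?_⟩⟩
    rw [sum_symmDiff_filter_neg_abs]
    constructor <;> linarith
end

section
/- Let a₁, …, aₙ be real numbers with |a_i| > 1 for all i, and let t be a real number. Then the number of subsets I ⊆ [n] such that ∑_{i ∈ I} a_i ∈ [t, t+1) is at most binom(n, ⌊n/2⌋). -/
open scoped symmDiff in
/-- Toggling the indices of the negative terms turns a subset sum of `a` into a subset sum
of `|a|`, up to a constant. -/
theorem sum_eq_sum_abs_symmDiff_add {ι : Type*} [Fintype ι] [DecidableEq ι] (a : ι → ℝ)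
    (I : Finset ι) :
    ∑ i ∈ I, a i = ∑ i ∈ I ∆ Finset.univ.filter (fun i => a i < 0), |a i| +
      ∑ i ∈ Finset.univ.filter (fun i => a i < 0), a i := by
  have key (s : Finset ι) (f : ι → ℝ) : ∑ i ∈ s, f i = ∑ i, if i ∈ s then f i else 0 := by simp
  rw [key I, key (I ∆ _), key (Finset.univ.filter _), ← Finset.sum_add_distrib]
  refine Finset.sum_congr rfl fun i _ => ?_
  by_cases hI : i ∈ I <;> rcases lt_or_ge (a i) 0 with h | h <;>
    simp [Finset.mem_symmDiff, hI, h, not_lt_of_ge, abs_of_neg, abs_of_nonneg]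

/-- If `s ⊂ t` and all terms of `f` exceed `1`, the sums over `s` and `t` differ by more
than `1`. -/
theorem sum_add_one_lt_sum_of_ssubset {ι : Type*} [DecidableEq ι] {f : ι → ℝ}
    (hf : ∀ i, 1 < f i) {s t : Finset ι} (hst : s ⊂ t) :
    ∑ i ∈ s, f i + 1 < ∑ i ∈ t, f i := by
  obtain ⟨j, hj, hjs⟩ := Finset.exists_of_ssubset hst
  have hle : ∑ i ∈ insert j s, f i ≤ ∑ i ∈ t, f i :=
    Finset.sum_le_sum_of_subset_of_nonneg (Finset.insert_subset hj hst.subset)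
      fun i _ _ => by linarith [hf i]
  rw [Finset.sum_insert hjs] at hle
  linarith [hf j]

open scoped symmDiff in
/-- Let `a₁,…,aₙ` be reals with `|a_i| > 1` for all `i`, and let `t ∈ ℝ`.
Then the number of subsets `I ⊆ [n]` with `∑_{i ∈ I} a_i ∈ [t, t+1)` is at most
`binom(n, ⌊n/2⌋)`. -/
theorem stmt_10 (n : ℕ) (a : Fin n → ℝ) (ha : ∀ i, 1 < |a i|) (t : ℝ) :
    (Finset.univ.filter (fun I : Finset (Fin n) =>
        t ≤ ∑ i ∈ I, a i ∧ ∑ i ∈ I, a i < t + 1)).card ≤ Nat.choose n (n / 2) := by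
  set N := Finset.univ.filter (fun i => a i < 0)
  rw [← Finset.card_image_of_injective _ (symmDiff_left_injective N)]
  have hanti : IsAntichain (· ⊆ ·) (SetLike.coe (Finset.image (· ∆ N) (Finset.univ.filter
      (fun I : Finset (Fin n) => t ≤ ∑ i ∈ I, a i ∧ ∑ i ∈ I, a i < t + 1)))) := by
    intro s hs u hu hne hsub
    simp only [SetLike.mem_coe, Finset.mem_image, Finset.mem_filter, Finset.mem_univ,
      true_and] at hs hu
    obtain ⟨I, ⟨hI, -⟩, rfl⟩ := hs
    obtain ⟨J, ⟨-, hJ⟩, rfl⟩ := hu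
    have hlt := sum_add_one_lt_sum_of_ssubset ha (hsub.ssubset_of_ne hne)
    rw [sum_eq_sum_abs_symmDiff_add a I] at hI
    rw [sum_eq_sum_abs_symmDiff_add a J] at hJ
    linarith
  simpa using hanti.sperner
end

section
/- Let M be a d × n real matrix whose first d columns form the identity matrix I_d, let w ∈ {0,1}ⁿ, and let 𝒟 be an antichain of subsets of [n] such that the characteristic vector of every D ∈ 𝒟 lies in the affine subspace w + span(rows of M) of ℝⁿ, and such that |𝒟| ≥ 8·2^d/√n. Then there exists a set C ⊆ [d] of rows of M with |C| ≥ d − n/20 − 10·log₂ n such that: (1) every row of M indexed by C has all entries in {0, 1, −1} and has at least one entry equal to −1; and (2) every column of M contains at most one nonzero entry among the rows indexed by C. -/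
open Finset

theorem centralBinom_sq_mul_le (k : ℕ) : k.centralBinom ^ 2 * (3 * k + 1) ≤ 16 ^ k := by
  induction k with
  | zero => simp
  | succ k ih =>
    have h := Nat.succ_mul_centralBinom_succ k
    have hpos : 0 < (k + 1) ^ 2 := by positivity
    refine Nat.le_of_mul_le_mul_left ?_ hpos
    calc (k + 1) ^ 2 * ((k + 1).centralBinom ^ 2 * (3 * (k + 1) + 1))
        = ((k + 1) * (k + 1).centralBinom) ^ 2 * (3 * k + 4) := by ring
      _ = k.centralBinom ^ 2 * (4 * ((2 * k + 1) ^ 2 * (3 * k + 4))) := by rw [h]; ring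
      _ ≤ k.centralBinom ^ 2 * (16 * ((k + 1) ^ 2 * (3 * k + 1))) := by
        refine Nat.mul_le_mul_left _ ?_
        nlinarith
      _ = 16 * (k + 1) ^ 2 * (k.centralBinom ^ 2 * (3 * k + 1)) := by ring
      _ ≤ 16 * (k + 1) ^ 2 * 16 ^ k := Nat.mul_le_mul_left _ ih
      _ = (k + 1) ^ 2 * 16 ^ (k + 1) := by ring

theorem choose_half_sq_mul_le (m : ℕ) : m.choose (m / 2) ^ 2 * (3 * m + 2) ≤ 2 * 4 ^ m := by
  obtain ⟨a, rfl | rfl⟩ := Nat.even_or_odd' m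
  · have h := centralBinom_sq_mul_le a
    rw [Nat.centralBinom] at h
    rw [Nat.mul_div_cancel_left _ (by norm_num), pow_mul]
    norm_num
    linarith
  · have h := centralBinom_sq_mul_le (a + 1)
    have h2 : (a + 1).centralBinom = 2 * (2 * a + 1).choose a := by
      rw [Nat.centralBinom, show 2 * (a + 1) = 2 * a + 1 + 1 by ring, Nat.choose_succ_succ,
        Nat.choose_symm_half]
      ring
    rw [h2, pow_succ 16] at h
    rw [show (2 * a + 1) / 2 = a by omega, pow_succ 4, pow_mul]
    norm_num
    nlinarith [sq_nonneg ((2 * a + 1).choose a)]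

theorem sq_mul_mul_le_four_pow {x y q A b : ℝ} {u m t : ℕ} (hx : 0 ≤ x) (hA : 0 ≤ A)
    (hb : 0 ≤ b) (hxy : x ≤ q * (2 ^ t * y)) (hy : y ^ 2 * A ≤ 4 ^ u) (hq : q ^ 2 * b ≤ 4 ^ m) :
    x ^ 2 * (A * b) ≤ 4 ^ (u + m + t) := by
  have h4 : (2 ^ t : ℝ) ^ 2 = 4 ^ t := by rw [← pow_mul, mul_comm, pow_mul]; norm_num
  calc x ^ 2 * (A * b) ≤ (q * (2 ^ t * y)) ^ 2 * (A * b) := by gcongr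
    _ = (y ^ 2 * A) * (q ^ 2 * b) * 4 ^ t := by rw [← h4]; ring
    _ ≤ 4 ^ u * 4 ^ m * 4 ^ t := by gcongr
    _ = 4 ^ (u + m + t) := by rw [pow_add, pow_add]

/-- A weight outside `{0, 1, -1}` cannot be switched on and off between the values `0` and `1`. -/
theorem card_le_one_of_weight {ι : Type*} (i : ι) (m : ι → ℝ) (hm : m i ≠ 0 ∧ m i ≠ 1 ∧ m i ≠ -1)
    (c : ℝ) (𝓕 : Finset (Finset ι)) (hS : ∀ x ∈ 𝓕, x ⊆ {i})
    (hc : ∀ x ∈ 𝓕, c + ∑ i ∈ x, m i = 0 ∨ c + ∑ i ∈ x, m i = 1) : #𝓕 ≤ 1 := by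
  obtain ⟨h0, h1, h2⟩ := hm
  rw [card_le_one]
  intro x hx y hy
  have hxc := hc x hx
  have hyc := hc y hy
  rcases subset_singleton_iff.1 (hS x hx) with rfl | rfl <;>
    rcases subset_singleton_iff.1 (hS y hy) with rfl | rfl
  · rfl
  · exfalso
    simp only [sum_empty, sum_singleton] at hxc hyc
    rcases hxc with h | h <;> rcases hyc with h' | h'
    exacts [h0 (by linarith), h1 (by linarith), h2 (by linarith), h0 (by linarith)]
  · exfalso
    simp only [sum_empty, sum_singleton] at hxc hyc
    rcases hxc with h | h <;> rcases hyc with h' | h'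
    exacts [h0 (by linarith), h2 (by linarith), h1 (by linarith), h0 (by linarith)]
  · rfl

section Families

variable {ι : Type*} [DecidableEq ι]

/-- Sperner's theorem for antichains of subsets of a given finite set. -/
theorem card_le_choose_of_antichain_subset (S : Finset ι) (𝓕 : Finset (Finset ι))
    (hS : ∀ x ∈ 𝓕, x ⊆ S) (h𝓕 : ∀ x ∈ 𝓕, ∀ y ∈ 𝓕, x ⊆ y → x = y) :
    #𝓕 ≤ (#S).choose (#S / 2) := by
  have hmap : ∀ x ∈ 𝓕, (x.subtype (· ∈ S)).map (Function.Embedding.subtype _) = x := by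
    intro x hx
    rw [subtype_map, filter_true_of_mem]
    exact fun i hi => hS x hx hi
  have hinj : Set.InjOn (fun x : Finset ι => x.subtype (· ∈ S)) 𝓕 := by
    intro x hx y hy hxy
    rw [← hmap x hx, ← hmap y hy]
    exact congrArg _ hxy
  rw [← card_image_of_injOn hinj, ← Fintype.card_coe S]
  refine IsAntichain.sperner ?_
  intro a ha b hb hne hab
  simp only [coe_image, Set.mem_image, mem_coe] at ha hb
  obtain ⟨x, hx, rfl⟩ := ha
  obtain ⟨y, hy, rfl⟩ := hb
  apply hne
  have : x ⊆ y := by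
    rw [← hmap x hx, ← hmap y hy]
    exact map_subset_map.2 hab
  rw [h𝓕 x hx y hy this]

/-- The Erdős–Littlewood–Offord bound for subset sums equal to a given value. -/
theorem card_sum_eq_le_choose (S : Finset ι) (m : ι → ℝ) (hm : ∀ i ∈ S, m i ≠ 0) (b : ℝ)
    (𝓕 : Finset (Finset ι)) (hS : ∀ x ∈ 𝓕, x ⊆ S) (hb : ∀ x ∈ 𝓕, ∑ i ∈ x, m i = b) :
    #𝓕 ≤ (#S).choose (#S / 2) := by
  set T := S.filter (fun i => m i < 0)
  have hTS : T ⊆ S := filter_subset _ _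
  rw [← card_image_of_injective 𝓕 (symmDiff_left_injective T)]
  refine card_le_choose_of_antichain_subset S _ ?_ ?_
  · simp only [mem_image, forall_exists_index, and_imp, forall_apply_eq_imp_iff₂]
    intro x hx i hi
    rcases mem_symmDiff.1 hi with h | h
    · exact hS x hx h.1
    · exact hTS h.1
  · simp only [mem_image, forall_exists_index, and_imp, forall_apply_eq_imp_iff₂]
    intro x hx y hy hxy
    have hsum : ∀ z ∈ 𝓕, ∑ i ∈ S, (if i ∈ z then m i else 0) = b := by
      intro z hz
      rw [← sum_filter, filter_mem_eq_inter, inter_eq_right.2 (hS z hz), hb z hz]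
    have hle : ∀ i ∈ S, (if i ∈ x then m i else 0) ≤ if i ∈ y then m i else 0 := by
      intro i hi
      have h := @hxy i
      simp only [mem_symmDiff, T, mem_filter, hi, true_and] at h
      rcases lt_or_ge (m i) 0 with hlt | hge
      · by_cases hx' : i ∈ x <;> by_cases hy' : i ∈ y <;> simp [hx', hy', hlt] at h ⊢
        exact hlt.le
      · by_cases hx' : i ∈ x <;> by_cases hy' : i ∈ y <;> simp [hx', hy', hge.not_gt] at h ⊢
        exact hge
    have heq := (sum_eq_sum_iff_of_le hle).1 ((hsum x hx).trans (hsum y hy).symm)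
    have : x = y := by
      ext i
      by_cases hi : i ∈ S
      · have h := heq i hi
        have h0 := hm i hi
        by_cases hx' : i ∈ x <;> by_cases hy' : i ∈ y <;> simp_all
      · exact ⟨fun h => absurd (hS x hx h) hi, fun h => absurd (hS y hy h) hi⟩
    rw [this]

/-- The Erdős–Littlewood–Offord bound for two consecutive values. -/
theorem card_sum_eq_zero_or_one_le_choose (S : Finset ι) (m : ι → ℝ) (hm : ∀ i ∈ S, m i ≠ 0)
    (c : ℝ) (𝓕 : Finset (Finset ι)) (hS : ∀ x ∈ 𝓕, x ⊆ S)
    (hc : ∀ x ∈ 𝓕, c + ∑ i ∈ x, m i = 0 ∨ c + ∑ i ∈ x, m i = 1) :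
    #𝓕 ≤ (#S + 1).choose ((#S + 1) / 2) := by
  classical
  let g : Finset ι → Finset (Option ι) := fun x =>
    if c + ∑ i ∈ x, m i = 0 then insertNone x else x.map Function.Embedding.some
  have hg : ∀ x, eraseNone (g x) = x := by
    intro x
    simp only [g]
    split_ifs <;> simp
  have hinj : Function.Injective g := Function.LeftInverse.injective hg
  have hcard : #(insertNone S) = #S + 1 := card_insertNone S
  rw [← card_image_of_injective 𝓕 hinj, ← hcard]
  refine card_sum_eq_le_choose (insertNone S) (fun o => o.elim 1 m) ?_ (1 - c) _ ?_ ?_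
  · rintro (_ | i) hi
    · simp
    · exact hm i (some_mem_insertNone.1 hi)
  · simp only [mem_image, forall_exists_index, and_imp, forall_apply_eq_imp_iff₂]
    intro x hx o ho
    rw [mem_insertNone]
    rintro i hi
    refine hS x hx ?_
    rw [← hg x]
    exact mem_eraseNone.2 (by rwa [← Option.mem_def.1 hi])
  · simp only [mem_image, forall_exists_index, and_imp, forall_apply_eq_imp_iff₂]
    intro x hx
    simp only [g]
    split_ifs with h
    · rw [sum_insertNone]
      simp only [Option.elim]
      linarith
    · rw [sum_map]
      have := (hc x hx).resolve_left h
      simp only [Function.Embedding.some_apply, Option.elim]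
      linarith

/-- Bounding the trace of `X` on `U ∪ S` by its trace on `U`, using a column that is supported
on `U ∪ S`. -/
theorem card_trace_union_le (X : Finset (Finset ι)) (U S : Finset ι) (hUS : Disjoint U S)
    (m : ι → ℝ) (hm : ∀ i, i ∉ U ∪ S → m i = 0) (v : ℝ)
    (hX : ∀ x ∈ X, v + ∑ i ∈ x, m i = 0 ∨ v + ∑ i ∈ x, m i = 1) (B : ℕ)
    (hB : ∀ (c : ℝ) (𝓕 : Finset (Finset ι)), (∀ x ∈ 𝓕, x ⊆ S) →
      (∀ x ∈ 𝓕, c + ∑ i ∈ x, m i = 0 ∨ c + ∑ i ∈ x, m i = 1) → #𝓕 ≤ B) :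
    #(X.image (· ∩ (U ∪ S))) ≤ B * #(X.image (· ∩ U)) := by
  have himg : (X.image (· ∩ (U ∪ S))).image (· ∩ U) = X.image (· ∩ U) := by
    rw [image_image]
    refine image_congr fun x _ => ?_
    simp only [Function.comp_apply]
    rw [inter_assoc, inter_eq_right.2 subset_union_left]
  rw [← himg]
  refine card_le_mul_card_image _ _ fun y _ => ?_
  have hdec : ∀ x : Finset ι, x ∩ (U ∪ S) = x ∩ U ∪ x ∩ S := fun x => inter_union_distrib_left _ _ _
  have hinj : Set.InjOn (· ∩ S) (filter (fun x => x ∩ U = y) (X.image (· ∩ (U ∪ S))) :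
      Set (Finset ι)) := by
    intro a ha b hb hab
    simp only [coe_filter, mem_image, Set.mem_ofPred_eq] at ha hb
    obtain ⟨⟨a', _, rfl⟩, ha⟩ := ha
    obtain ⟨⟨b', _, rfl⟩, hb⟩ := hb
    have h1 := ha.trans hb.symm
    simp only [inter_assoc, inter_eq_right.2 (subset_union_left : U ⊆ U ∪ S),
      inter_eq_right.2 (subset_union_right : S ⊆ U ∪ S)] at h1 hab
    rw [hdec, hdec, h1, hab]
  rw [← card_image_of_injOn hinj]
  refine hB (v + ∑ i ∈ y, m i) _ ?_ ?_
  · intro x hx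
    obtain ⟨z, _, rfl⟩ := mem_image.1 hx
    exact inter_subset_right
  · intro x hx
    obtain ⟨z, hz, rfl⟩ := mem_image.1 hx
    obtain ⟨hz, hy⟩ := mem_filter.1 hz
    obtain ⟨a, ha, rfl⟩ := mem_image.1 hz
    have hsum : ∑ i ∈ a, m i = ∑ i ∈ y, m i + ∑ i ∈ a ∩ (U ∪ S) ∩ S, m i := by
      rw [← hy, inter_assoc, inter_eq_right.2 (subset_union_left : U ⊆ U ∪ S), inter_assoc,
        inter_eq_right.2 (subset_union_right : S ⊆ U ∪ S),
        ← sum_union (hUS.mono inter_subset_right inter_subset_right), ← hdec]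
      refine (sum_subset inter_subset_left fun i hi hi' => hm i fun h => hi' ?_).symm
      exact mem_inter.2 ⟨hi, h⟩
    rw [add_assoc, ← hsum]
    exact hX a ha

/-- If `X` is an antichain in the directions of `N`, its size is controlled by its trace on the
complement of `N`, and hence by its trace on any set disjoint from `N`. -/
theorem card_le_of_antichain_fibers [Fintype ι] (X : Finset (Finset ι)) (U N : Finset ι)
    (hUN : Disjoint U N) (hX : ∀ x ∈ X, ∀ y ∈ X, x \ N = y \ N → x ⊆ y → x = y) :
    #X ≤ (#N).choose (#N / 2) * (2 ^ (Fintype.card ι - #U - #N) * #(X.image (· ∩ U))) := by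
  have h1 : #X ≤ (#N).choose (#N / 2) * #(X.image (· \ N)) := by
    refine card_le_mul_card_image _ _ fun y _ => ?_
    have hsub : ∀ a b : Finset ι, a \ N = b \ N → a ∩ N ⊆ b ∩ N → a ⊆ b := by
      intro a b h h'
      rw [← sdiff_union_inter a N, ← sdiff_union_inter b N, h]
      exact union_subset_union_right h'
    have hinj : Set.InjOn (· ∩ N) (filter (fun x => x \ N = y) X : Set (Finset ι)) := by
      intro a ha b hb hab
      simp only [coe_filter, Set.mem_ofPred_eq] at ha hb hab
      exact (hsub a b (ha.2.trans hb.2.symm) hab.le).antisymm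
        (hsub b a (hb.2.trans ha.2.symm) hab.ge)
    rw [← card_image_of_injOn hinj]
    refine card_le_choose_of_antichain_subset N _ ?_ ?_
    · intro x hx
      obtain ⟨z, _, rfl⟩ := mem_image.1 hx
      exact inter_subset_right
    · intro x hx x' hx' hxx'
      obtain ⟨a, ha, rfl⟩ := mem_image.1 hx
      obtain ⟨b, hb, rfl⟩ := mem_image.1 hx'
      obtain ⟨ha, ha'⟩ := mem_filter.1 ha
      obtain ⟨hb, hb'⟩ := mem_filter.1 hb
      have hab := ha'.trans hb'.symm
      rw [hX a ha b hb hab (hsub a b hab hxx')]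
  have h2 : #(X.image (· \ N)) ≤ 2 ^ (Fintype.card ι - #U - #N) * #(X.image (· ∩ U)) := by
    have himg : (X.image (· \ N)).image (· ∩ U) = X.image (· ∩ U) := by
      rw [image_image]
      refine image_congr fun x _ => ?_
      ext i
      have : i ∈ U → i ∉ N := fun h => disjoint_left.1 hUN h
      simp only [Function.comp_apply, mem_inter, mem_sdiff]
      tauto
    rw [← himg]
    refine card_le_mul_card_image _ _ fun y _ => ?_
    have hcard : #(univ \ (U ∪ N)) = Fintype.card ι - #U - #N := by
      rw [card_sdiff_of_subset (subset_univ _), card_union_of_disjoint hUN, card_univ, Nat.sub_sub]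
    rw [← hcard, ← card_powerset]
    refine card_le_card_of_injOn (· \ (U ∪ N)) ?_ ?_
    · intro x _
      simp
    · intro a ha b hb hab
      simp only [coe_filter, mem_image, Set.mem_ofPred_eq] at ha hb hab
      obtain ⟨⟨a', _, rfl⟩, ha⟩ := ha
      obtain ⟨⟨b', _, rfl⟩, hb⟩ := hb
      have h := ha.trans hb.symm
      ext i
      have h3 := Finset.ext_iff.1 h i
      have h4 := Finset.ext_iff.1 hab i
      simp only [mem_sdiff, mem_inter, mem_union] at h3 h4 ⊢
      tauto
  exact h1.trans (Nat.mul_le_mul_left _ h2)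

/-- `U` is a set of rows on which `X` has a trace of density at most `A ^ (-1/2)`, while the size
of `U` is at most linear in `A`. -/
def IsSparseTrace (X : Finset (Finset ι)) (U : Finset ι) (A : ℝ) : Prop :=
  (#(X.image (· ∩ U)) : ℝ) ^ 2 * A ≤ 4 ^ #U ∧ (3 * #U + 5 : ℝ) ≤ 8 * A ∧
    (U = ∅ ∧ A = 1 ∨ 7 / 4 ≤ A)

theorem IsSparseTrace.union {X : Finset (Finset ι)} {U S : Finset ι} {A a : ℝ} {B : ℕ}
    (h : IsSparseTrace X U A) (hUS : Disjoint U S)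
    (hB : #(X.image (· ∩ (U ∪ S))) ≤ B * #(X.image (· ∩ U)))
    (hBa : (B : ℝ) ^ 2 * a ≤ 4 ^ #S) (ha : 7 / 4 ≤ a) (hSa : (3 * #S + 5 : ℝ) ≤ 8 * a) :
    IsSparseTrace X (U ∪ S) (A * a) := by
  obtain ⟨h1, h2, h3⟩ := h
  have hA : 0 ≤ A := by rcases h3 with h | h <;> linarith
  refine ⟨?_, ?_, ?_⟩
  · have hB' : (#(X.image (· ∩ (U ∪ S))) : ℝ) ≤ B * #(X.image (· ∩ U)) := by exact_mod_cast hB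
    calc (#(X.image (· ∩ (U ∪ S))) : ℝ) ^ 2 * (A * a)
        ≤ (B * #(X.image (· ∩ U))) ^ 2 * (A * a) := by gcongr
      _ = ((#(X.image (· ∩ U)) : ℝ) ^ 2 * A) * (B ^ 2 * a) := by ring
      _ ≤ 4 ^ #U * 4 ^ #S := by gcongr
      _ = 4 ^ #(U ∪ S) := by rw [card_union_of_disjoint hUS, pow_add]
  · rw [card_union_of_disjoint hUS]
    push_cast
    rcases h3 with ⟨rfl, rfl⟩ | h3
    · simpa using hSa
    · nlinarith [mul_nonneg (sub_nonneg.2 h3) (sub_nonneg.2 ha)]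
  · right
    rcases h3 with ⟨_, rfl⟩ | h3
    · simpa using ha
    · nlinarith

theorem exists_choose_half_bound (k : ℕ) (hk : 2 ≤ k) :
    ∃ a : ℝ, ((k + 1).choose ((k + 1) / 2) : ℝ) ^ 2 * a ≤ 4 ^ k ∧ 7 / 4 ≤ a ∧
      (3 * k + 5 : ℝ) ≤ 8 * a := by
  rcases hk.eq_or_lt with rfl | hk
  · refine ⟨16 / 9, ?_, ?_, ?_⟩ <;> norm_num [Nat.choose]
  · refine ⟨(3 * k + 5) / 8, ?_, ?_, by linarith⟩
    · have h : (((k + 1).choose ((k + 1) / 2) : ℝ)) ^ 2 * (3 * (k + 1 : ℕ) + 2) ≤ 2 * 4 ^ (k + 1) :=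
        by exact_mod_cast choose_half_sq_mul_le (k + 1)
      rw [pow_succ 4] at h
      push_cast at h
      linarith
    · have : (3 : ℝ) ≤ k := by exact_mod_cast hk
      linarith

/-- A dense enough family of row subsets on which every column sum is `0` or `1`, and which is an
antichain for the coordinatewise order of the column sums, forces almost all rows to be
disjointly supported with entries in `{0, 1, -1}`, including `-1`. -/
theorem exists_disjoint_rows [Fintype ι] {J : Type*} (M : ι → J → ℝ) (v : J → ℝ)
    (X : Finset (Finset ι))
    (h01 : ∀ x ∈ X, ∀ j, v j + ∑ i ∈ x, M i j = 0 ∨ v j + ∑ i ∈ x, M i j = 1)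
    (hX : ∀ x ∈ X, ∀ y ∈ X, (∀ j, ∑ i ∈ x, M i j ≤ ∑ i ∈ y, M i j) → x = y)
    (n : ℝ) (hn : 64 * 4 ^ Fintype.card ι ≤ (#X : ℝ) ^ 2 * n) :
    ∃ C : Finset ι, (Fintype.card ι : ℝ) - n / 20 ≤ #C ∧
      (∀ i ∈ C, (∀ j, M i j = 0 ∨ M i j = 1 ∨ M i j = -1) ∧ ∃ j, M i j = -1) ∧
      ∀ j, #(C.filter (fun i => M i j ≠ 0)) ≤ 1 := by
  classical
  have hne : (univ.filter fun U => ∃ A, IsSparseTrace X U A).Nonempty := by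
    refine ⟨∅, mem_filter.2 ⟨mem_univ _, 1, ?_, by norm_num, Or.inl ⟨rfl, rfl⟩⟩⟩
    have : #(X.image (· ∩ (∅ : Finset ι))) ≤ 1 :=
      card_le_one.2 (by simp +contextual [mem_image])
    have h : (#(X.image (· ∩ (∅ : Finset ι))) : ℝ) ≤ 1 := by exact_mod_cast this
    simpa using h
  obtain ⟨U, hU, hmax⟩ := exists_max_image _ card hne
  obtain ⟨A, hA⟩ := (mem_filter.1 hU).2
  have hstep : ∀ (j : J) (B : ℕ) (a : ℝ), (univ.filter fun i => i ∉ U ∧ M i j ≠ 0).Nonempty →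
      (∀ (c : ℝ) (𝓕 : Finset (Finset ι)), (∀ x ∈ 𝓕, x ⊆ univ.filter fun i => i ∉ U ∧ M i j ≠ 0) →
        (∀ x ∈ 𝓕, c + ∑ i ∈ x, M i j = 0 ∨ c + ∑ i ∈ x, M i j = 1) → #𝓕 ≤ B) →
      (B : ℝ) ^ 2 * a ≤ 4 ^ #(univ.filter fun i => i ∉ U ∧ M i j ≠ 0) → 7 / 4 ≤ a →
      (3 * #(univ.filter fun i => i ∉ U ∧ M i j ≠ 0) + 5 : ℝ) ≤ 8 * a → False := by
    intro j B a hS hB h1 h2 h3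
    set S := univ.filter fun i => i ∉ U ∧ M i j ≠ 0
    have hUS : Disjoint U S := disjoint_left.2 fun i hi hi' => (mem_filter.1 hi').2.1 hi
    have htr := card_trace_union_le X U S hUS (fun i => M i j) ?_ (v j) (fun x hx => h01 x hx j) B hB
    · have hU' := hmax (U ∪ S) (mem_filter.2 ⟨mem_univ _, _, hA.union hUS htr h1 h2 h3⟩)
      rw [card_union_of_disjoint hUS] at hU'
      have := hS.card_pos
      omega
    · intro i hi
      by_contra h
      apply hi
      by_cases hiU : i ∈ U
      · exact mem_union_left _ hiU
      · exact mem_union_right _ (mem_filter.2 ⟨mem_univ _, hiU, h⟩)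
  have hcol : ∀ j, #(univ.filter fun i => i ∉ U ∧ M i j ≠ 0) ≤ 1 := by
    intro j
    by_contra! hk
    obtain ⟨a, h1, h2, h3⟩ := exists_choose_half_bound _ hk
    refine hstep j _ a (card_pos.1 (by omega)) (fun c 𝓕 hS hc => ?_) h1 h2 h3
    exact card_sum_eq_zero_or_one_le_choose _ _ (fun i hi => (mem_filter.1 hi).2.2) c 𝓕 hS hc
  have hent : ∀ i, i ∉ U → ∀ j, M i j = 0 ∨ M i j = 1 ∨ M i j = -1 := by
    intro i hi j
    by_contra! h
    have hi' : i ∈ univ.filter fun i => i ∉ U ∧ M i j ≠ 0 := mem_filter.2 ⟨mem_univ _, hi, h.1⟩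
    have hS : (univ.filter fun i => i ∉ U ∧ M i j ≠ 0) = {i} :=
      eq_singleton_iff_unique_mem.2 ⟨hi', fun b hb => card_le_one.1 (hcol j) b hb i hi'⟩
    refine hstep j 1 4 ⟨i, hi'⟩ (fun c 𝓕 h𝓕 hc => ?_) ?_ (by norm_num) ?_
    · rw [hS] at h𝓕
      exact card_le_one_of_weight i (fun i => M i j) h c 𝓕 h𝓕 hc
    · rw [hS]; norm_num
    · rw [hS]; norm_num
  set N := univ.filter fun i => i ∉ U ∧ ∀ j, M i j ≠ -1
  have hUN : Disjoint U N := disjoint_left.2 fun i hi hi' => (mem_filter.1 hi').2.1 hi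
  have hfib := card_le_of_antichain_fibers X U N hUN (by
    intro x hx y hy hxy hsub
    refine hX x hx y hy fun j => sum_le_sum_of_subset_of_nonneg hsub fun i hi hi' => ?_
    have hiN : i ∈ N := by
      by_contra hiN
      have := mem_sdiff.2 ⟨hi, hiN⟩
      rw [← hxy] at this
      exact hi' (mem_sdiff.1 this).1
    obtain ⟨hiU, hneg⟩ := (mem_filter.1 hiN).2
    rcases hent i hiU j with h | h | h
    · exact h.ge
    · rw [h]; norm_num
    · exact absurd h (hneg j))
  have hcardUN : #U + #N ≤ Fintype.card ι := by
    rw [← card_union_of_disjoint hUN]; exact card_le_univ _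
  refine ⟨univ \ (U ∪ N), ?_, ?_, ?_⟩
  · rw [card_sdiff_of_subset (subset_univ _), card_union_of_disjoint hUN, card_univ,
      Nat.cast_sub hcardUN, Nat.cast_add]
    suffices h : (#U : ℝ) + #N ≤ n / 20 by linarith
    obtain ⟨hA1, hA2, hA3⟩ := hA
    have hA1' : 1 ≤ A := by rcases hA3 with h | h <;> linarith
    obtain ⟨t, ht⟩ : ∃ t, t = Fintype.card ι - #U - #N := ⟨_, rfl⟩
    rw [← ht] at hfib
    have hd : Fintype.card ι = #U + #N + t := by omega
    have hq : ((#N).choose (#N / 2) : ℝ) ^ 2 * ((3 * #N + 2) / 2) ≤ 4 ^ #N := by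
      have : ((#N).choose (#N / 2) : ℝ) ^ 2 * (3 * #N + 2) ≤ 2 * 4 ^ #N := by
        exact_mod_cast choose_half_sq_mul_le #N
      linarith
    have hfib' : (#X : ℝ) ≤ (#N).choose (#N / 2) * (2 ^ t * #(X.image (· ∩ U))) := by
      exact_mod_cast hfib
    have hN0 : (0 : ℝ) ≤ #N := Nat.cast_nonneg _
    have hprod : (#X : ℝ) ^ 2 * (A * ((3 * #N + 2) / 2)) ≤ 4 ^ Fintype.card ι := by
      rw [hd]
      exact sq_mul_mul_le_four_pow (Nat.cast_nonneg _) (by linarith) (by linarith) hfib' hA1 hq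
    have hXpos : 0 < (#X : ℝ) ^ 2 := by
      rcases (sq_nonneg (#X : ℝ)).eq_or_lt with h | h
      · rw [← h, zero_mul] at hn
        have : (0 : ℝ) < 64 * 4 ^ Fintype.card ι := by positivity
        linarith
      · exact h
    have hfinal : 64 * (A * ((3 * #N + 2) / 2)) ≤ n := by
      refine le_of_mul_le_mul_left ?_ hXpos
      linarith
    nlinarith [mul_nonneg hN0 (sub_nonneg.2 hA1')]
  · intro i hi
    have hi' := (mem_sdiff.1 hi).2
    rw [mem_union, not_or] at hi'
    refine ⟨hent i hi'.1, ?_⟩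
    by_contra! h
    exact hi'.2 (mem_filter.2 ⟨mem_univ _, hi'.1, h⟩)
  · intro j
    refine (card_le_card fun i hi => ?_).trans (hcol j)
    obtain ⟨hi, hij⟩ := mem_filter.1 hi
    refine mem_filter.2 ⟨mem_univ _, fun h => (mem_sdiff.1 hi).2 (mem_union_left _ h), hij⟩

end Families

/-- Let `M` be a `d × n` real matrix whose first `d` columns form `I_d`,
let `w ∈ {0,1}ⁿ`, and let `𝒟` be an antichain of subsets of `[n]` whose characteristic
vectors lie in `w + span(rows of M)`, with `|𝒟| ≥ 8·2^d/√n`. Then there is a set `C ⊆ [d]`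
of rows with `|C| ≥ d − n/20 − 10·log₂ n` such that every row in `C` has entries in
`{0,1,−1}` with at least one `−1`, and every column of `M` has at most one nonzero entry
among the rows of `C`. -/
theorem stmt_11 (d n : ℕ) (hdn : d ≤ n) (M : Fin d → Fin n → ℝ)
    (hM : ∀ i j : Fin d, M i ⟨j, lt_of_lt_of_le j.isLt hdn⟩ = if i = j then 1 else 0)
    (w : Fin n → ℝ) (hw : ∀ j, w j = 0 ∨ w j = 1)
    (𝒟 : Finset (Finset (Fin n)))
    (hanti : ∀ D ∈ 𝒟, ∀ D' ∈ 𝒟, D ≠ D' → ¬ D ⊆ D')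
    (hspan : ∀ D ∈ 𝒟,
      ((fun j => if j ∈ D then (1 : ℝ) else 0) - w) ∈ Submodule.span ℝ (Set.range M))
    (hcard : (8 : ℝ) * 2 ^ d / Real.sqrt n ≤ 𝒟.card) :
    ∃ C : Finset (Fin d),
      (d : ℝ) - (n : ℝ) / 20 - 10 * Real.logb 2 n ≤ C.card ∧
      (∀ i ∈ C, (∀ j, M i j = 0 ∨ M i j = 1 ∨ M i j = -1) ∧ ∃ j, M i j = -1) ∧
      (∀ j : Fin n, (C.filter (fun i => M i j ≠ 0)).card ≤ 1) := by
  classical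
  set e : Fin d → Fin n := fun i => ⟨i, lt_of_lt_of_le i.isLt hdn⟩
  set p : Finset (Fin n) → Finset (Fin d) := fun D => univ.filter fun i => e i ∈ D with hp
  set v : Fin n → ℝ := fun j => w j - ∑ i, w (e i) * M i j with hv
  have hrep : ∀ D ∈ 𝒟, ∀ j, (if j ∈ D then (1 : ℝ) else 0) = v j + ∑ i ∈ p D, M i j := by
    intro D hD j
    obtain ⟨c, hc⟩ := (Submodule.mem_span_range_iff_exists_fun ℝ).1 (hspan D hD)
    have hval : ∀ j, ∑ i, c i * M i j = (if j ∈ D then (1 : ℝ) else 0) - w j := by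
      intro j
      simpa using congrFun hc j
    have hcoef : ∀ i, c i = (if e i ∈ D then (1 : ℝ) else 0) - w (e i) := by
      intro i
      rw [← hval (e i)]
      simp [e, hM]
    have h := hval j
    simp only [hcoef, sub_mul, sum_sub_distrib, ite_mul, one_mul, zero_mul] at h
    rw [hv, hp, sum_filter]
    linarith
  have hmono : ∀ D ∈ 𝒟, ∀ D' ∈ 𝒟, (∀ j, ∑ i ∈ p D, M i j ≤ ∑ i ∈ p D', M i j) → D = D' := by
    intro D hD D' hD' h
    by_contra hne
    refine hanti D hD D' hD' hne fun j hj => ?_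
    by_contra hj'
    have h1 := hrep D hD j
    have h2 := hrep D' hD' j
    rw [if_pos hj] at h1
    rw [if_neg hj'] at h2
    linarith [h j]
  have hinj : Set.InjOn p 𝒟 := fun D hD D' hD' h => hmono D hD D' hD' fun j => by rw [h]
  rcases Nat.eq_zero_or_pos n with rfl | hn
  · exact ⟨∅, by simpa using hdn, by simp, by simp⟩
  have hn' : (0 : ℝ) < n := by exact_mod_cast hn
  obtain ⟨C, hC, hC'⟩ := exists_disjoint_rows M v (𝒟.image p) (by
      simp only [mem_image, forall_exists_index, and_imp, forall_apply_eq_imp_iff₂]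
      intro D hD j
      rw [← hrep D hD j]
      split_ifs <;> simp) (by
      simp only [mem_image, forall_exists_index, and_imp, forall_apply_eq_imp_iff₂]
      intro D hD D' hD' h
      rw [hmono D hD D' hD' h]) n (by
      rw [card_image_of_injOn hinj, Fintype.card_fin]
      rw [div_le_iff₀ (Real.sqrt_pos.2 hn')] at hcard
      calc (64 : ℝ) * 4 ^ d = (8 * 2 ^ d) ^ 2 := by
            rw [mul_pow, ← pow_mul, mul_comm d 2, pow_mul]; norm_num
        _ ≤ (#𝒟 * Real.sqrt n) ^ 2 := by gcongr
        _ = (#𝒟 : ℝ) ^ 2 * n := by rw [mul_pow, Real.sq_sqrt hn'.le])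
  refine ⟨C, ?_, hC'⟩
  have hlog : 0 ≤ Real.logb 2 n := Real.logb_nonneg (by norm_num) (by exact_mod_cast hn)
  rw [Fintype.card_fin] at hC
  linarith
end

section
/- Let M be a d × n real matrix whose first d columns form the identity matrix I_d, let w ∈ {0,1}ⁿ, and let 𝒟 be an antichain of subsets of [n] such that the characteristic vector of every D ∈ 𝒟 lies in the affine subspace w + span(rows of M) of ℝⁿ, and such that |𝒟| ≥ 8·2^d/√n. Then there exists a set R ⊆ [d] with |R| ≤ n/25 + 10·log₂ n such that every column of M contains at most one nonzero entry among the rows indexed by [d] \ R. -/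
open Finset in
/-- The sum of `|a i|` over the sign-corrected set `T ∆ {a < 0}` is a translate of `∑ i ∈ T, a i`. -/
lemma sum_abs_symmDiff_neg {ι : Type*} [Fintype ι] [DecidableEq ι] (a : ι → ℝ) (T : Finset ι) :
    ∑ i ∈ symmDiff T (univ.filter fun i => a i < 0), |a i|
      = ∑ i ∈ T, a i + ∑ i ∈ univ.filter (fun i => a i < 0), |a i| := by
  rw [← Fintype.sum_ite_mem (symmDiff T _), ← Fintype.sum_ite_mem T,
    ← Fintype.sum_ite_mem (univ.filter _), ← Finset.sum_add_distrib]
  refine Finset.sum_congr rfl fun i _ => ?_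
  by_cases hT : i ∈ T <;> by_cases ha : a i < 0
  · simp [Finset.mem_symmDiff, hT, ha, abs_of_neg ha]
  · simp [Finset.mem_symmDiff, hT, ha, abs_of_nonneg (not_lt.mp ha)]
  · simp [Finset.mem_symmDiff, hT, ha]
  · simp [Finset.mem_symmDiff, hT, ha]

open Finset in
/-- The Littlewood–Offord bound of Erdős for a single value. -/
lemma card_sum_eq_le_choose_s12 {ι : Type*} [Fintype ι] [DecidableEq ι] (a : ι → ℝ)
    (ha : ∀ i, a i ≠ 0) (v : ℝ) :
    #(univ.filter fun T : Finset ι => ∑ i ∈ T, a i = v)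
      ≤ (Fintype.card ι).choose (Fintype.card ι / 2) := by
  set N := univ.filter fun i => a i < 0 with hN
  rw [← Finset.card_image_of_injective _ (symmDiff_left_injective N)]
  refine IsAntichain.sperner ?_
  rintro A hA B hB hne hsub
  simp only [coe_image, coe_filter, mem_univ, true_and, Set.mem_image, Set.mem_ofPred_eq] at hA hB
  obtain ⟨S, hS, rfl⟩ := hA
  obtain ⟨T, hT, rfl⟩ := hB
  obtain ⟨x, hx, hxS⟩ := Finset.exists_of_ssubset (lt_of_le_of_ne hsub hne)
  have hlt := Finset.sum_lt_sum_of_subset (f := fun i => |a i|) hsub hx hxS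
    (abs_pos.mpr (ha x)) fun _ _ _ => abs_nonneg _
  simp only [hN, sum_abs_symmDiff_neg, hS, hT, lt_irrefl] at hlt

open Finset in
/-- The number of subset sums of nonzero reals that hit one of the values `v`, `v + 1`. -/
lemma card_sum_eq_or_le_choose {ι : Type*} [Fintype ι] [DecidableEq ι] (a : ι → ℝ)
    (ha : ∀ i, a i ≠ 0) (v : ℝ) :
    #(univ.filter fun T : Finset ι => ∑ i ∈ T, a i = v ∨ ∑ i ∈ T, a i = v + 1)
      ≤ 2 * (Fintype.card ι).choose (Fintype.card ι / 2) := by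
  rw [Finset.filter_or, two_mul]
  exact (card_union_le _ _).trans
    (add_le_add (card_sum_eq_le_choose_s12 a ha v) (card_sum_eq_le_choose_s12 a ha (v + 1)))

open Finset in
/-- With at least two nonzero summands, at most three quarters of the subset sums lie in
`{v, v + 1}`. -/
lemma four_mul_card_sum_eq_or_le {ι : Type*} [Fintype ι] [DecidableEq ι] (a : ι → ℝ)
    (ha : ∀ i, a i ≠ 0) (hι : 2 ≤ Fintype.card ι) (v : ℝ) :
    4 * #(univ.filter fun T : Finset ι => ∑ i ∈ T, a i = v ∨ ∑ i ∈ T, a i = v + 1)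
      ≤ 3 * 2 ^ Fintype.card ι := by
  obtain ⟨x, y, hxy⟩ := Fintype.exists_pair_of_one_lt_card (by omega : 1 < Fintype.card ι)
  have hbad : ∀ B : Finset ι, x ∉ B → y ∉ B → ∃ T : Finset ι, T \ {x, y} = B ∧
      ¬(∑ i ∈ T, a i = v ∨ ∑ i ∈ T, a i = v + 1) := by
    intro B hx hy
    by_contra! h
    have h0 := h B (by ext i; simp; grind)
    have h1 := h (insert x B) (by ext i; simp; grind)
    have h2 := h (insert y B) (by ext i; simp; grind)
    have h3 := h (insert x (insert y B)) (by ext i; simp; grind)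
    have hx' : x ∉ insert y B := by simp [hxy, hx]
    rw [sum_insert hx] at h1
    rw [sum_insert hy] at h2
    rw [sum_insert hx', sum_insert hy] at h3
    have := ha x
    have := ha y
    grind
  choose! g hg hg' using hbad
  have hdisj : #(({x, y} : Finset ι)ᶜ.powerset) ≤
      #(univ.filter fun T : Finset ι => ¬(∑ i ∈ T, a i = v ∨ ∑ i ∈ T, a i = v + 1)) := by
    refine card_le_card_of_injOn g (fun B hB => ?_) fun B hB C hC h => ?_
    · have : x ∉ B ∧ y ∉ B := by
        simp only [coe_powerset, Set.mem_preimage, Set.mem_powerset_iff] at hB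
        constructor <;> intro hmem <;> simpa using hB hmem
      simpa using hg' B this.1 this.2
    · have key : ∀ B ∈ (({x, y} : Finset ι)ᶜ.powerset : Set (Finset ι)), x ∉ B ∧ y ∉ B := by
        intro B hB
        simp only [coe_powerset, Set.mem_preimage, Set.mem_powerset_iff] at hB
        constructor <;> intro hmem <;> simpa using hB hmem
      rw [← hg B (key B hB).1 (key B hB).2, h, hg C (key C hC).1 (key C hC).2]
  have htot := card_filter_add_card_filter_not (s := (univ : Finset (Finset ι)))
    (fun T : Finset ι => ∑ i ∈ T, a i = v ∨ ∑ i ∈ T, a i = v + 1)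
  rw [card_powerset, card_compl, card_pair hxy] at hdisj
  rw [card_univ, Fintype.card_finset] at htot
  obtain ⟨m, hm⟩ := Nat.exists_eq_add_of_le hι
  rw [hm] at hdisj htot ⊢
  rw [Nat.add_sub_cancel_left] at hdisj
  rw [pow_add] at htot ⊢
  omega

/-- Wallis' product bounds the central binomial coefficient: `π m (2m choose m)² ≤ 16 ^ m`. -/
lemma pi_mul_centralBinom_sq_le (m : ℕ) :
    Real.pi * m * (m.centralBinom : ℝ) ^ 2 ≤ 16 ^ m := by
  have h := Real.Wallis.le_W m
  have hc : (m.centralBinom : ℝ) * (m.factorial : ℝ) ^ 2 = ((2 * m).factorial : ℝ) := by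
    have := Nat.choose_mul_factorial_mul_factorial (show m ≤ 2 * m by omega)
    rw [show 2 * m - m = m by omega] at this
    rw [Nat.centralBinom_eq_two_mul_choose, ← this]
    push_cast
    ring
  have hf : (0 : ℝ) < (m.factorial : ℝ) := by exact_mod_cast m.factorial_pos
  have hC : (0 : ℝ) < (m.centralBinom : ℝ) := by exact_mod_cast m.centralBinom_pos
  have hW : Real.Wallis.W m * ((m.centralBinom : ℝ) ^ 2 * (2 * m + 1)) = 16 ^ m := by
    rw [Real.Wallis.W_eq_factorial_ratio, ← hc, pow_mul]
    field_simp
    norm_num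
  rw [← hW]
  have hm : (0 : ℝ) ≤ m := m.cast_nonneg
  calc Real.pi * m * (m.centralBinom : ℝ) ^ 2
      ≤ ((2 * m + 1) / (2 * m + 2) * (Real.pi / 2))
          * ((m.centralBinom : ℝ) ^ 2 * (2 * m + 1)) := by
        have : Real.pi * m ≤ ((2 * m + 1) / (2 * m + 2) * (Real.pi / 2)) * (2 * m + 1) := by
          rw [div_mul_div_comm, div_mul_eq_mul_div, le_div_iff₀ (by positivity)]
          nlinarith [Real.pi_pos]
        nlinarith [mul_le_mul_of_nonneg_right this (sq_nonneg (m.centralBinom : ℝ))]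
    _ ≤ _ := mul_le_mul_of_nonneg_right h (by positivity)

/-- The two-layer Sperner bound `2 (k choose k/2)` is at most `1.6 · 2 ^ k / √k`. -/
lemma sq_two_mul_choose_half_mul_le (k : ℕ) :
    (2 * (k.choose (k / 2) : ℝ)) ^ 2 * k ≤ 64 / 25 * 4 ^ k := by
  have key : ∀ m : ℕ, (m.centralBinom : ℝ) ^ 2 * m ≤ 8 / 25 * 16 ^ m := by
    intro m
    have h := pi_mul_centralBinom_sq_le m
    have h0 : (0 : ℝ) ≤ (m.centralBinom : ℝ) ^ 2 * m := by positivity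
    nlinarith [Real.pi_gt_d2]
  obtain ⟨m, rfl | rfl⟩ := Nat.even_or_odd' k
  · rw [show 2 * m / 2 = m by omega, ← Nat.centralBinom_eq_two_mul_choose, pow_mul]
    have := key m
    push_cast
    norm_num
    linarith
  · rw [show (2 * m + 1) / 2 = m by omega]
    have h2 : (m + 1).centralBinom = 2 * (2 * m + 1).choose m := by
      rw [Nat.centralBinom_eq_two_mul_choose, show 2 * (m + 1) = 2 * m + 1 + 1 by ring,
        Nat.choose_succ_succ, Nat.choose_symm_half]
      ring
    have h3 : ((m + 1).centralBinom : ℝ) = 2 * (2 * m + 1).choose m := by exact_mod_cast h2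
    have := key (m + 1)
    rw [← h3, pow_succ 4, pow_mul]
    rw [pow_succ 16] at this
    push_cast at this ⊢
    norm_num
    nlinarith [sq_nonneg ((m + 1).centralBinom : ℝ)]

open Finset in
/-- Enlarging `R` by the rest `U` of the support of `a` multiplies the number of traces of `𝒢`
by at most the number of subsets of `U` with sum in a translate of `{0, 1}`. -/
lemma card_image_inter_union_le {ι : Type*} [DecidableEq ι] (𝒢 : Finset (Finset ι)) (a : ι → ℝ)
    (c : ℝ) (h𝒢 : ∀ S ∈ 𝒢, ∑ i ∈ S, a i = c ∨ ∑ i ∈ S, a i = c + 1) (R U : Finset ι)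
    (hRU : Disjoint R U) (hsupp : ∀ i, a i ≠ 0 → i ∈ R ∪ U) (N : ℕ)
    (hN : ∀ v : ℝ, #(univ.filter fun T : Finset U =>
      ∑ i ∈ T, a i = v ∨ ∑ i ∈ T, a i = v + 1) ≤ N) :
    #(𝒢.image (· ∩ (R ∪ U))) ≤ N * #(𝒢.image (· ∩ R)) := by
  refine card_le_mul_card_image_of_maps_to (f := (· ∩ R)) ?_ N ?_
  · simp only [mem_image]
    rintro _ ⟨S, hS, rfl⟩
    exact ⟨S, hS, by ext i; simp⟩
  · intro B hB
    refine le_trans ?_ (hN (c - ∑ i ∈ B, a i))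
    refine card_le_card_of_injOn (fun A => A.subtype (· ∈ U)) ?_ ?_
    · intro A hA
      simp only [coe_filter, mem_image, Set.mem_ofPred_eq] at hA
      obtain ⟨⟨S, hS, rfl⟩, hB⟩ := hA
      have hsum : ∑ i ∈ S, a i = ∑ i ∈ B, a i + ∑ i ∈ (S ∩ (R ∪ U)).subtype (· ∈ U), a i := by
        have h1 : ∑ i ∈ S, a i = ∑ i ∈ S ∩ (R ∪ U), a i := by
          refine (sum_subset inter_subset_left fun i hi hi' => ?_).symm
          by_contra h
          exact hi' (mem_inter.mpr ⟨hi, hsupp i h⟩)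
        have h2 : ∑ i ∈ (S ∩ (R ∪ U)).subtype (· ∈ U), a i
            = ∑ i ∈ (S ∩ (R ∪ U)).filter (· ∈ U), a i := sum_subtype_eq_sum_filter a
        rw [h1, h2, ← hB, ← sum_filter_not_add_sum_filter _ (· ∈ U)]
        congr 1
        refine sum_congr ?_ fun _ _ => rfl
        ext i
        have : i ∈ R → i ∉ U := fun hi => disjoint_left.mp hRU hi
        simp only [mem_filter, mem_inter, mem_union]
        tauto
      simp only [coe_filter, mem_univ, true_and, Set.mem_ofPred_eq]
      rcases h𝒢 S hS with h | h
      · left; linarith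
      · right; linarith
    · intro A hA A' hA' h
      simp only [coe_filter, mem_image, Set.mem_ofPred_eq] at hA hA'
      obtain ⟨⟨S, -, rfl⟩, hB⟩ := hA
      obtain ⟨⟨S', -, rfl⟩, hB'⟩ := hA'
      ext i
      have h1 : i ∈ S ∩ (R ∪ U) ∩ R ↔ i ∈ S' ∩ (R ∪ U) ∩ R := by rw [hB, hB']
      have h2 : ∀ hi : i ∈ U, i ∈ S ∩ (R ∪ U) ↔ i ∈ S' ∩ (R ∪ U) := by
        intro hi
        have := Finset.ext_iff.mp h ⟨i, hi⟩
        simpa only [mem_subtype] using this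
      simp only [mem_inter, mem_union] at h1 h2 ⊢
      tauto

open Finset in
/-- A family `𝒢` whose sums along every column of `M` lie in a translate of `{0, 1}` leaves, for
some `Q ≥ 1` with `|𝒢|² Q ≤ 4 ^ |ι|`, a set `R` of about `64 Q / 25` rows outside of which every
column has at most one nonzero entry. -/
lemma exists_rows_of_sums {ι κ : Type*} [Fintype ι] [DecidableEq ι] (M : ι → κ → ℝ) (c : κ → ℝ)
    (𝒢 : Finset (Finset ι))
    (h𝒢 : ∀ S ∈ 𝒢, ∀ j, ∑ i ∈ S, M i j = c j ∨ ∑ i ∈ S, M i j = c j + 1) :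
    ∃ (R : Finset ι) (Q : ℝ), 1 ≤ Q ∧ (#𝒢 : ℝ) ^ 2 * Q ≤ 4 ^ Fintype.card ι ∧
      (#R : ℝ) ≤ 64 / 25 * Q + 10 * Real.logb 2 Q ∧
      ∀ j, #((univ \ R).filter fun i => M i j ≠ 0) ≤ 1 := by
  classical
  let good : Finset ι → Prop := fun R => ∃ Q : ℝ, 1 ≤ Q ∧
    (#(𝒢.image (· ∩ R)) : ℝ) ^ 2 * Q ≤ 4 ^ #R ∧ (#R : ℝ) ≤ 64 / 25 * Q + 10 * Real.logb 2 Q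
  have hempty : good ∅ := by
    refine ⟨1, le_rfl, ?_, by norm_num⟩
    have : #(𝒢.image (· ∩ (∅ : Finset ι))) ≤ 1 := by
      refine card_le_one.mpr fun A hA B hB => ?_
      simp only [inter_empty, mem_image] at hA hB
      obtain ⟨_, _, rfl⟩ := hA
      obtain ⟨_, _, rfl⟩ := hB
      rfl
    have h1 : (#(𝒢.image (· ∩ (∅ : Finset ι))) : ℝ) ≤ 1 := by exact_mod_cast this
    rw [mul_one, card_empty, pow_zero]
    exact pow_le_one₀ (Nat.cast_nonneg _) h1
  obtain ⟨R, hR, hmax⟩ := exists_max_image (univ.filter good) card ⟨∅, by simpa using hempty⟩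
  simp only [mem_filter, mem_univ, true_and] at hR hmax
  obtain ⟨Q, hQ, hcount, hcard⟩ := hR
  refine ⟨R, Q, hQ, ?_, hcard, ?_⟩
  · have hle : #𝒢 ≤ 2 ^ (Fintype.card ι - #R) * #(𝒢.image (· ∩ R)) := by
      refine card_le_mul_card_image_of_maps_to (f := (· ∩ R))
        (fun S hS => mem_image_of_mem _ hS) _ fun B _ => ?_
      rw [← card_compl, ← card_powerset]
      refine card_le_card_of_injOn (· \ R) (fun S _ => ?_) fun S hS T hT h => ?_
      · simp
      · simp only [coe_filter, Set.mem_ofPred_eq] at hS hT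
        rw [← sdiff_union_inter S R, ← sdiff_union_inter T R, hS.2, hT.2]
        exact congrArg (· ∪ B) h
    have hle' : (#𝒢 : ℝ) ≤ 2 ^ (Fintype.card ι - #R) * #(𝒢.image (· ∩ R)) := by
      exact_mod_cast hle
    calc (#𝒢 : ℝ) ^ 2 * Q
        ≤ (2 ^ (Fintype.card ι - #R) * #(𝒢.image (· ∩ R))) ^ 2 * Q := by gcongr
      _ = 4 ^ (Fintype.card ι - #R) * ((#(𝒢.image (· ∩ R)) : ℝ) ^ 2 * Q) := by
          rw [mul_pow, ← pow_mul, mul_comm _ 2, pow_mul]; norm_num; ring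
      _ ≤ 4 ^ (Fintype.card ι - #R) * 4 ^ #R := by gcongr
      _ = 4 ^ Fintype.card ι := by rw [← pow_add, Nat.sub_add_cancel (card_le_univ R)]
  · by_contra! hj
    obtain ⟨j, hj⟩ := hj
    set U := (univ \ R).filter fun i => M i j ≠ 0 with hU
    have hRU : Disjoint R U := disjoint_left.mpr fun i hi hi' => by simp [hU, hi] at hi'
    have hne : ∀ i : U, M i j ≠ 0 := fun i => (mem_filter.mp i.2).2
    have hcU : Fintype.card U = #U := Fintype.card_coe U
    set N := min (2 * (#U).choose (#U / 2)) (3 * 2 ^ #U / 4) with hN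
    have hstep := card_image_inter_union_le 𝒢 (M · j) (c j) (fun S hS => h𝒢 S hS j) R U hRU
      (fun i hi => by simp only [hU, mem_union, mem_filter, mem_sdiff, mem_univ]; tauto) N
      (fun v => by
        have h1 := card_sum_eq_or_le_choose (fun i : U => M i j) hne v
        have h2 := four_mul_card_sum_eq_or_le (fun i : U => M i j) hne (by omega) v
        rw [hcU] at h1 h2
        exact le_min h1 (by omega))
    set q : ℝ := max (16 / 9) (25 / 64 * #U) with hq
    have hq1 : 16 / 9 ≤ q := le_max_left _ _
    have hNq : (N : ℝ) ^ 2 * q ≤ 4 ^ #U := by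
      rw [hq, mul_max_of_nonneg _ _ (sq_nonneg _)]
      refine max_le ?_ ?_
      · have h1 : 4 * N ≤ 3 * 2 ^ #U := by
          have : N ≤ 3 * 2 ^ #U / 4 := min_le_right _ _
          omega
        have h2 : 4 * (N : ℝ) ≤ 3 * 2 ^ #U := by exact_mod_cast h1
        have h3 : (4 * (N : ℝ)) ^ 2 ≤ (3 * 2 ^ #U) ^ 2 := by gcongr
        have h4 : ((2 : ℝ) ^ #U) ^ 2 = 4 ^ #U := by rw [← pow_mul, mul_comm, pow_mul]; norm_num
        rw [mul_pow 3, h4] at h3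
        linarith
      · have h1 : (N : ℝ) ≤ 2 * ((#U).choose (#U / 2) : ℝ) := by
          exact_mod_cast min_le_left _ _
        have h2 : (N : ℝ) ^ 2 * #U ≤ (2 * ((#U).choose (#U / 2) : ℝ)) ^ 2 * #U := by gcongr
        have := sq_two_mul_choose_half_mul_le #U
        linarith
    have hgood : good (R ∪ U) := by
      refine ⟨Q * q, by nlinarith, ?_, ?_⟩
      · have hstep' : (#(𝒢.image (· ∩ (R ∪ U))) : ℝ) ≤ N * #(𝒢.image (· ∩ R)) := by
          exact_mod_cast hstep
        calc (#(𝒢.image (· ∩ (R ∪ U))) : ℝ) ^ 2 * (Q * q)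
            ≤ (N * #(𝒢.image (· ∩ R))) ^ 2 * (Q * q) := by gcongr
          _ = ((#(𝒢.image (· ∩ R)) : ℝ) ^ 2 * Q) * ((N : ℝ) ^ 2 * q) := by ring
          _ ≤ 4 ^ #R * 4 ^ #U := by gcongr
          _ = 4 ^ #(R ∪ U) := by rw [card_union_of_disjoint hRU, pow_add]
      · have hlog : 1 / 2 ≤ Real.logb 2 q := by
          rw [Real.le_logb_iff_rpow_le (by norm_num) (by linarith), ← Real.sqrt_eq_rpow,
            Real.sqrt_le_left (by linarith)]
          nlinarith
        have hUq : (#U : ℝ) ≤ 64 / 25 * q := by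
          have : 25 / 64 * (#U : ℝ) ≤ q := le_max_right _ _
          linarith
        rw [card_union_of_disjoint hRU, Real.logb_mul (by positivity) (by positivity)]
        push_cast
        nlinarith [mul_nonneg (sub_nonneg.mpr hQ) (by linarith : (0 : ℝ) ≤ q - 1)]
    have := hmax _ hgood
    rw [card_union_of_disjoint hRU] at this
    omega

/-- Let `M` be a `d × n` real matrix whose first `d` columns form `I_d`,
let `w ∈ {0,1}ⁿ`, and let `𝒟` be an antichain of subsets of `[n]` whose characteristic
vectors lie in `w + span(rows of M)`, with `|𝒟| ≥ 8·2^d/√n`. Then there is a set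
`R ⊆ [d]` with `|R| ≤ n/25 + 10·log₂ n` such that every column of `M` contains at most one
nonzero entry among the rows indexed by `[d] \ R`. -/
theorem stmt_12 (d n : ℕ) (hdn : d ≤ n) (M : Fin d → Fin n → ℝ)
    (hM : ∀ i j : Fin d, M i ⟨j, lt_of_lt_of_le j.isLt hdn⟩ = if i = j then 1 else 0)
    (w : Fin n → ℝ) (hw : ∀ j, w j = 0 ∨ w j = 1)
    (𝒟 : Finset (Finset (Fin n)))
    (hanti : ∀ D ∈ 𝒟, ∀ D' ∈ 𝒟, D ≠ D' → ¬ D ⊆ D')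
    (hspan : ∀ D ∈ 𝒟,
      ((fun j => if j ∈ D then (1 : ℝ) else 0) - w) ∈ Submodule.span ℝ (Set.range M))
    (hcard : (8 : ℝ) * 2 ^ d / Real.sqrt n ≤ 𝒟.card) :
    ∃ R : Finset (Fin d),
      (R.card : ℝ) ≤ (n : ℝ) / 25 + 10 * Real.logb 2 n ∧
      (∀ j : Fin n, ((Finset.univ \ R).filter (fun i => M i j ≠ 0)).card ≤ 1) := by
  rcases Nat.eq_zero_or_pos n with rfl | hn
  · exact ⟨∅, by simp, fun j => j.elim0⟩
  let e : Fin d → Fin n := fun i => ⟨i, lt_of_lt_of_le i.isLt hdn⟩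
  let trace : Finset (Fin n) → Finset (Fin d) := fun D => Finset.univ.filter fun i => e i ∈ D
  let c : Fin n → ℝ := fun j => ∑ i, w (e i) * M i j - w j
  have hcol : ∀ D ∈ 𝒟, ∀ j, ∑ i ∈ trace D, M i j = c j + if j ∈ D then (1 : ℝ) else 0 := by
    intro D hD j
    obtain ⟨b, hb⟩ := (Submodule.mem_span_range_iff_exists_fun ℝ).mp (hspan D hD)
    have hbj : ∀ j, ∑ i, b i * M i j = (if j ∈ D then (1 : ℝ) else 0) - w j := fun j => by
      simpa using congrFun hb j
    have hcoef : ∀ i, b i = (if e i ∈ D then (1 : ℝ) else 0) - w (e i) := fun i => by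
      rw [← hbj (e i)]
      simp [e, hM]
    have hj := hbj j
    simp only [hcoef, sub_mul, Finset.sum_sub_distrib, ite_mul, one_mul, zero_mul,
      ← Finset.sum_filter] at hj
    simp only [trace, c]
    linarith
  have hinj : Set.InjOn trace 𝒟 := by
    intro D hD D' hD' h
    ext j
    have h1 := hcol D hD j
    rw [h, hcol D' hD' j] at h1
    by_cases hj : j ∈ D <;> by_cases hj' : j ∈ D' <;> simp_all
  obtain ⟨R, Q, hQ, hcount, hR, hrows⟩ := exists_rows_of_sums M c (𝒟.image trace) (by
    intro S hS j
    obtain ⟨D, hD, rfl⟩ := Finset.mem_image.mp hS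
    rw [hcol D hD j]
    by_cases hj : j ∈ D <;> simp [hj])
  refine ⟨R, hR.trans ?_, hrows⟩
  rw [Finset.card_image_of_injOn hinj, Fintype.card_fin] at hcount
  have hn0 : (0 : ℝ) < n := by exact_mod_cast hn
  have hQn : 64 * Q ≤ n := by
    have h1 : (8 * 2 ^ d / Real.sqrt n) ^ 2 * Q ≤ 4 ^ d :=
      le_trans (by gcongr) hcount
    have h2 : ((2 : ℝ) ^ d) ^ 2 = 4 ^ d := by rw [← pow_mul, mul_comm, pow_mul]; norm_num
    rw [div_pow, mul_pow, h2, Real.sq_sqrt hn0.le, div_mul_eq_mul_div, div_le_iff₀ hn0] at h1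
    have h4 : (0 : ℝ) < 4 ^ d := by positivity
    refine le_of_mul_le_mul_left ?_ h4
    linarith
  have hlog : Real.logb 2 Q ≤ Real.logb 2 n :=
    Real.logb_le_logb_of_le (by norm_num) (by linarith) (by linarith)
  linarith
end

section
/- Let W be a linear subspace of ℝⁿ with dim W = k. Then the number of vectors v ∈ {0,1}ⁿ with v ∈ W is at most 2^k. -/
/-- In a finite-dimensional space, any family `φ` of linear functionals contains at most
`finrank K V` members that already separate all the points separated by `φ`. -/
theorem exists_finite_separating_subset {K V ι : Type*} [Field K] [AddCommGroup V] [Module K V]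
    [FiniteDimensional K V] (φ : ι → Module.Dual K V) :
    ∃ b ⊆ Set.range φ, b.Finite ∧ b.ncard ≤ Module.finrank K V ∧
      ∀ x y : V, (∀ f ∈ b, f x = f y) → ∀ i, φ i x = φ i y := by
  obtain ⟨b, hb, hspan, hli⟩ := exists_linearIndependent K (Set.range φ)
  have hfin : Finite b := hli.finite
  refine ⟨b, hb, hfin, ?_, fun x y hxy i => ?_⟩
  · have := Fintype.ofFinite b
    rw [← Subspace.dual_finrank_eq (K := K) (V := V), ← Nat.card_coe_set_eq,
      Nat.card_eq_fintype_card]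
    exact hli.fintype_card_le_finrank
  · have hi : φ i ∈ Submodule.span K b := hspan ▸ Submodule.subset_span ⟨i, rfl⟩
    have hle : Submodule.span K b ≤
        LinearMap.eqLocus (Module.Dual.eval K V x) (Module.Dual.eval K V y) :=
      Submodule.span_le.2 fun f hf => hxy f hf
    exact hle hi

/-- Let `W ≤ ℝⁿ` be a linear subspace with `dim W = k`. Then the number
of vectors `v ∈ {0,1}ⁿ` with `v ∈ W` is at most `2^k`. -/
theorem stmt_14 (n k : ℕ) (W : Submodule ℝ (Fin n → ℝ)) (hW : Module.finrank ℝ W = k) :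
    Set.ncard {v : Fin n → ℝ | (∀ i, v i = 0 ∨ v i = 1) ∧ v ∈ W} ≤ 2 ^ k := by
  obtain ⟨b, hb, hfin, hcard, hsep⟩ := exists_finite_separating_subset
    fun i : Fin n => (LinearMap.proj i : (Fin n → ℝ) →ₗ[ℝ] ℝ) ∘ₗ W.subtype
  have : Finite b := hfin
  rw [← Nat.card_coe_set_eq]
  let g : {v : Fin n → ℝ | (∀ i, v i = 0 ∨ v i = 1) ∧ v ∈ W} → b → Prop :=
    fun v f => f.1 ⟨v.1, v.2.2⟩ = 1
  have hg : Function.Injective g := by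
    rintro ⟨v, hv, hvW⟩ ⟨w, hw, hwW⟩ hvw
    refine Subtype.ext (funext fun i => hsep ⟨v, hvW⟩ ⟨w, hwW⟩ (fun f hf => ?_) i)
    have h : (f ⟨v, hvW⟩ = 1) = (f ⟨w, hwW⟩ = 1) := congrFun hvw ⟨f, hf⟩
    obtain ⟨j, rfl⟩ := hb hf
    change (v j = 1) = (w j = 1) at h
    change v j = w j
    rcases hv j with h₁ | h₁ <;> rcases hw j with h₂ | h₂ <;> simp_all
  calc _ ≤ Nat.card (b → Prop) := Nat.card_le_card_of_injective g hg
    _ = 2 ^ b.ncard := by simp [Nat.card_fun]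
    _ ≤ 2 ^ k := Nat.pow_le_pow_right two_pos (hW ▸ hcard)
end

section
/- Let W be a linear subspace of ℝⁿ with dim W = k and let w ∈ ℝⁿ. Then the number of vectors v ∈ {0,1}ⁿ with v ∈ w + W is at most 2^k. -/
/-- A subspace `W` of `K^ι` has a set of at most `dim W` coordinates that determine the
elements of `W`. -/
theorem Submodule.exists_finset_card_le_finrank_forall_eq_zero {K ι : Type*} [Field K]
    [Finite ι] (W : Submodule K (ι → K)) :
    ∃ s : Finset ι, s.card ≤ Module.finrank K W ∧
      ∀ x ∈ W, (∀ i ∈ s, x i = 0) → x = 0 := by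
  classical
  let f : ι → Module.Dual K W := fun i => (LinearMap.proj i : (ι → K) →ₗ[K] K) ∘ₗ W.subtype
  obtain ⟨κ, a, ha, hspan, hli⟩ := exists_linearIndependent' K f
  have : Finite κ := Finite.of_injective a ha
  have : Fintype κ := Fintype.ofFinite κ
  refine ⟨Finset.univ.image a, ?_, fun x hx h => ?_⟩
  · rw [Finset.card_image_of_injective _ ha, Finset.card_univ, ← Subspace.dual_finrank_eq]
    exact hli.fintype_card_le_finrank
  · have hker : Submodule.span K (Set.range (f ∘ a)) ≤
        LinearMap.ker (Module.Dual.eval K W ⟨x, hx⟩) := by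
      rw [Submodule.span_le]
      rintro _ ⟨j, rfl⟩
      exact h (a j) (Finset.mem_image_of_mem a (Finset.mem_univ j))
    rw [hspan] at hker
    funext i
    exact hker (Submodule.subset_span ⟨i, rfl⟩)

/-- Let `W ≤ ℝⁿ` be a linear subspace with `dim W = k` and let `w ∈ ℝⁿ`.
Then the number of vectors `v ∈ {0,1}ⁿ` with `v ∈ w + W` is at most `2^k`. -/
theorem stmt_15 (n k : ℕ) (W : Submodule ℝ (Fin n → ℝ)) (hW : Module.finrank ℝ W = k)
    (w : Fin n → ℝ) :
    Set.ncard {v : Fin n → ℝ | (∀ i, v i = 0 ∨ v i = 1) ∧ ∃ x ∈ W, v = w + x} ≤ 2 ^ k := by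
  classical
  obtain ⟨s, hs, hzero⟩ := W.exists_finset_card_le_finrank_forall_eq_zero
  rw [hW] at hs
  let t : Finset (s → ℝ) := Fintype.piFinset fun _ => {0, 1}
  have ht : t.card = 2 ^ s.card := by simp [t, Fintype.card_piFinset]
  calc _ ≤ (t : Set (s → ℝ)).ncard := by
        refine Set.ncard_le_ncard_of_injOn (fun v i => v i) ?_ ?_ t.finite_toSet
        · rintro v ⟨hv, -⟩
          simpa [t, Fintype.mem_piFinset] using fun i _ => hv i
        · rintro _ ⟨-, x, hx, rfl⟩ _ ⟨-, y, hy, rfl⟩ hxy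
          have hsub : x - y = 0 := hzero _ (W.sub_mem hx hy) fun i hi => by
            simpa [sub_eq_zero] using congrFun hxy ⟨i, hi⟩
          rw [sub_eq_zero.mp hsub]
    _ = 2 ^ s.card := by rw [Set.ncard_coe_finset, ht]
    _ ≤ 2 ^ k := Nat.pow_le_pow_right two_pos hs
end

section
/- Let (𝒜, ℬ) be an ℓ-cross-intersecting pair of families of subsets of [n] with ℬ nonempty, and fix B₁ ∈ ℬ. Let F_𝒜 = span_ℝ{χ_A : A ∈ 𝒜} and F'_ℬ = span_ℝ{χ_B − χ_{B₁} : B ∈ ℬ}, where χ_S ∈ {0,1}ⁿ ⊂ ℝⁿ denotes the characteristic vector of S ⊆ [n]. Then F_𝒜 and F'_ℬ are orthogonal subspaces of ℝⁿ (with respect to the standard inner product), and consequently dim F_𝒜 + dim F'_ℬ ≤ n. -/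
/-- The dot product of the indicator functions of `A` and `B` is the size of `A ∩ B`. -/
theorem sum_indicator_mul_indicator {ι : Type*} [Fintype ι] [DecidableEq ι] (A B : Finset ι) :
    ∑ i, (if i ∈ A then (1 : ℝ) else 0) * (if i ∈ B then 1 else 0) = ((A ∩ B).card : ℝ) := by
  simp only [← ite_and, mul_ite, mul_one, mul_zero, Finset.sum_boole]
  congr 2
  ext i
  simp [and_comm]

/-- Spans of two sets of pairwise orthogonal vectors are orthogonal. -/
theorem dotProduct_eq_zero_of_mem_span {ι : Type*} [Fintype ι] {s t : Set (ι → ℝ)}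
    (h : ∀ x ∈ s, ∀ y ∈ t, x ⬝ᵥ y = 0) {x y : ι → ℝ}
    (hx : x ∈ Submodule.span ℝ s) (hy : y ∈ Submodule.span ℝ t) : x ⬝ᵥ y = 0 := by
  induction hx, hy using Submodule.span_induction₂ with
  | mem_mem x y hx hy => exact h x hx y hy
  | zero_left y hy => exact zero_dotProduct y
  | zero_right x hx => exact dotProduct_zero x
  | add_left x y z _ _ _ h₁ h₂ => rw [add_dotProduct, h₁, h₂, add_zero]
  | add_right x y z _ _ _ h₁ h₂ => rw [dotProduct_add, h₁, h₂, add_zero]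
  | smul_left r x y _ _ h => rw [smul_dotProduct, h, smul_zero]
  | smul_right r x y _ _ h => rw [dotProduct_smul, h, smul_zero]

/-- The dimensions of two orthogonal subspaces of `ℝ^ι` add up to at most the size of `ι`. -/
theorem finrank_add_finrank_le_of_dotProduct_eq_zero {ι : Type*} [Fintype ι]
    {U V : Submodule ℝ (ι → ℝ)} (h : ∀ x ∈ U, ∀ y ∈ V, x ⬝ᵥ y = 0) :
    Module.finrank ℝ U + Module.finrank ℝ V ≤ Fintype.card ι := by
  have hUV : Disjoint U V := Submodule.disjoint_def.2 fun x hU hV =>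
    dotProduct_self_eq_zero.1 (h x hU x hV)
  simpa using Submodule.finrank_add_finrank_le_of_disjoint hUV

/-- Let `(𝒜, ℬ)` be `ℓ`-cross-intersecting with `B₁ ∈ ℬ`. Let
`F_𝒜 = span{χ_A : A ∈ 𝒜}` and `F'_ℬ = span{χ_B − χ_{B₁} : B ∈ ℬ}`. Then `F_𝒜` and `F'_ℬ`
are orthogonal subspaces of `ℝⁿ`, and consequently `dim F_𝒜 + dim F'_ℬ ≤ n`. -/
theorem stmt_16 (n ℓ : ℕ) (𝒜 ℬ : Finset (Finset (Fin n)))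
    (hcross : ∀ A ∈ 𝒜, ∀ B ∈ ℬ, (A ∩ B).card = ℓ)
    (B₁ : Finset (Fin n)) (hB₁ : B₁ ∈ ℬ)
    (χ : Finset (Fin n) → Fin n → ℝ)
    (hχ : ∀ S j, χ S j = if j ∈ S then 1 else 0)
    (FA FB : Submodule ℝ (Fin n → ℝ))
    (hFA : FA = Submodule.span ℝ {x | ∃ A ∈ 𝒜, x = χ A})
    (hFB : FB = Submodule.span ℝ {x | ∃ B ∈ ℬ, x = χ B - χ B₁}) :
    (∀ x ∈ FA, ∀ y ∈ FB, ∑ i, x i * y i = 0) ∧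
    Module.finrank ℝ FA + Module.finrank ℝ FB ≤ n := by
  have orth : ∀ x ∈ FA, ∀ y ∈ FB, x ⬝ᵥ y = 0 := by
    subst hFA hFB
    intro x hx y hy
    refine dotProduct_eq_zero_of_mem_span ?_ hx hy
    rintro _ ⟨A, hA, rfl⟩ _ ⟨B, hB, rfl⟩
    have hdot : ∀ S, χ A ⬝ᵥ χ S = ((A ∩ S).card : ℝ) := fun S => by
      simp only [dotProduct, hχ, sum_indicator_mul_indicator]
    rw [dotProduct_sub, hdot, hdot, hcross A hA B hB, hcross A hA B₁ hB₁, sub_self]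
  exact ⟨orth, by simpa using finrank_add_finrank_le_of_dotProduct_eq_zero orth⟩
end

section
/- Let ℓ ≥ 1. For every natural number x one has binom(x, ℓ)·2^(2ℓ) ≤ binom(2ℓ, ℓ)·2^x, with equality if and only if x ∈ {2ℓ−1, 2ℓ}. In other words, the function x ↦ binom(x, ℓ)/2^x on the natural numbers attains its maximum exactly at x = 2ℓ−1 and x = 2ℓ. -/
theorem Nat.choose_succ_lt_two_mul_choose {n k : ℕ} (hk : 1 ≤ k) (h : 2 * k ≤ n) :
    (n + 1).choose k < 2 * n.choose k := by
  obtain ⟨d, rfl⟩ : ∃ d, n = k + d := ⟨n - k, by omega⟩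
  have hpos : 0 < (k + d).choose k := Nat.choose_pos (by omega)
  have hrec := Nat.choose_mul_succ_eq (k + d) k
  rw [show k + d + 1 - k = d + 1 by omega] at hrec
  by_contra! hle
  nlinarith

theorem Nat.two_mul_choose_lt_choose_succ {n k : ℕ} (hk : k ≤ n + 1) (h : n + 2 ≤ 2 * k) :
    2 * n.choose k < (n + 1).choose k := by
  obtain ⟨d, hd⟩ : ∃ d, n + 1 = k + d := ⟨n + 1 - k, by omega⟩
  have hpos : 0 < (n + 1).choose k := Nat.choose_pos hk
  have hrec := Nat.choose_mul_succ_eq n k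
  rw [show n + 1 - k = d by omega] at hrec
  by_contra! hle
  nlinarith

theorem Nat.two_mul_choose_le_choose_succ {n k : ℕ} (h : n + 2 ≤ 2 * k) :
    2 * n.choose k ≤ (n + 1).choose k := by
  rcases le_or_gt k (n + 1) with hk | hk
  · exact (Nat.two_mul_choose_lt_choose_succ hk h).le
  · simp [Nat.choose_eq_zero_of_lt (show n < k by omega)]

theorem Nat.choose_two_mul_eq_two_mul_choose_pred {k : ℕ} (hk : 1 ≤ k) :
    (2 * k).choose k = 2 * (2 * k - 1).choose k := by
  have hrec := Nat.choose_mul_succ_eq (2 * k - 1) k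
  rw [show 2 * k - 1 + 1 = 2 * k by omega, show 2 * k - k = k by omega] at hrec
  exact Nat.eq_of_mul_eq_mul_right hk (by linarith)

theorem Nat.choose_two_mul_add_succ_lt {k : ℕ} (hk : 1 ≤ k) (j : ℕ) :
    (2 * k + (j + 1)).choose k < (2 * k).choose k * 2 ^ (j + 1) := by
  induction j with
  | zero =>
    have := Nat.choose_succ_lt_two_mul_choose hk le_rfl
    simpa [mul_comm] using this
  | succ j ih =>
    have := Nat.choose_succ_lt_two_mul_choose hk (show 2 * k ≤ 2 * k + (j + 1) by omega)
    rw [pow_succ, ← add_assoc]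
    linarith

theorem Nat.choose_mul_two_pow_le_choose_add {n k : ℕ} (j : ℕ) (h : n + j + 1 ≤ 2 * k) :
    n.choose k * 2 ^ j ≤ (n + j).choose k := by
  induction j with
  | zero => simp
  | succ j ih =>
    have := Nat.two_mul_choose_le_choose_succ (show n + j + 2 ≤ 2 * k by omega)
    have := ih (by omega)
    rw [pow_succ, ← add_assoc]
    linarith

theorem Nat.choose_mul_two_pow_lt_choose_two_mul {n k : ℕ} (hk : 1 ≤ k) (j : ℕ)
    (h : n + j + 2 = 2 * k) : n.choose k * 2 ^ (j + 2) < (2 * k).choose k := by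
  have hle := Nat.choose_mul_two_pow_le_choose_add j (show n + j + 1 ≤ 2 * k by omega)
  have hlt := Nat.two_mul_choose_lt_choose_succ (show k ≤ n + j + 1 by omega) h.le
  rw [Nat.choose_two_mul_eq_two_mul_choose_pred hk, show 2 * k - 1 = n + j + 1 by omega, pow_add]
  linarith

/-- Let `ℓ ≥ 1`. For every `x : ℕ`,
`binom(x, ℓ)·2^(2ℓ) ≤ binom(2ℓ, ℓ)·2^x`, with equality iff `x ∈ {2ℓ−1, 2ℓ}`. -/
theorem stmt_17 (ℓ : ℕ) (hℓ : 1 ≤ ℓ) (x : ℕ) :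
    Nat.choose x ℓ * 2 ^ (2 * ℓ) ≤ Nat.choose (2 * ℓ) ℓ * 2 ^ x ∧
    (Nat.choose x ℓ * 2 ^ (2 * ℓ) = Nat.choose (2 * ℓ) ℓ * 2 ^ x ↔
      x = 2 * ℓ - 1 ∨ x = 2 * ℓ) := by
  by_cases hx : x = 2 * ℓ - 1 ∨ x = 2 * ℓ
  · have heq : Nat.choose x ℓ * 2 ^ (2 * ℓ) = Nat.choose (2 * ℓ) ℓ * 2 ^ x := by
      rcases hx with rfl | rfl
      · rw [Nat.choose_two_mul_eq_two_mul_choose_pred hℓ,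
          ← mul_pow_sub_one (show 2 * ℓ ≠ 0 by omega) 2]
        ring
      · rfl
    exact ⟨heq.le, iff_of_true heq hx⟩
  · have hlt : Nat.choose x ℓ * 2 ^ (2 * ℓ) < Nat.choose (2 * ℓ) ℓ * 2 ^ x := by
      rcases lt_or_ge x (2 * ℓ) with h | h
      · obtain ⟨j, hj⟩ : ∃ j, x + j + 2 = 2 * ℓ := ⟨2 * ℓ - x - 2, by omega⟩
        have := Nat.choose_mul_two_pow_lt_choose_two_mul hℓ j hj
        calc x.choose ℓ * 2 ^ (2 * ℓ) = x.choose ℓ * 2 ^ (j + 2) * 2 ^ x := by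
              rw [← hj]; ring
          _ < _ := by gcongr
      · obtain ⟨j, rfl⟩ : ∃ j, x = 2 * ℓ + (j + 1) := ⟨x - 2 * ℓ - 1, by omega⟩
        have := Nat.choose_two_mul_add_succ_lt hℓ j
        calc _ < (2 * ℓ).choose ℓ * 2 ^ (j + 1) * 2 ^ (2 * ℓ) := by gcongr
          _ = _ := by ring
    exact ⟨hlt.le, iff_of_false hlt.ne hx⟩
end
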